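/- Let μ be a finite Borel measure on ℝ with Borel transform F, and let a < b be real numbers. Then the absolutely continuous part μ_ac of μ vanishes on (a, b), i.e. μ_ac((a, b)) = 0, if and only if lim_{y↘0} Im F(x+iy) = 0 for Lebesgue-almost every x ∈ (a, b). -/

import Mathlib

open MeasureTheory Filter Complex Set

/-- The Borel transform of a measure on `ℝ`. -/
noncomputable def borelTransform (μ : Measure ℝ) (z : ℂ) : ℂ :=
  ∫ t : ℝ, (1 : ℂ) / ((t : ℂ) - z) ∂μ

lemma one_div_sub_im (t x y : ℝ) :
    ((1 : ℂ) / ((t : ℂ) - ((x : ℂ) + y * Complex.I))).im = y / ((t - x) ^ 2 + y ^ 2) := by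
  simp [Complex.normSq_apply]
  ring

lemma integrable_one_div_sub (μ : Measure ℝ) [IsFiniteMeasure μ] (x : ℝ) {y : ℝ} (hy : 0 < y) :
    Integrable (fun t : ℝ => (1 : ℂ) / ((t : ℂ) - ((x : ℂ) + y * Complex.I))) μ := by
  refine Integrable.of_bound (C := 1 / y)
    (Measurable.aestronglyMeasurable (by fun_prop)) (Eventually.of_forall fun t => ?_)
  rw [norm_div, norm_one]
  refine one_div_le_one_div_of_le hy ?_
  have h := Complex.abs_im_le_norm ((t : ℂ) - ((x : ℂ) + y * Complex.I))
  simpa [abs_of_pos hy] using h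

lemma integrable_poissonKernel (μ : Measure ℝ) [IsFiniteMeasure μ] (x : ℝ) {y : ℝ} (hy : 0 < y) :
    Integrable (fun t : ℝ => y / ((t - x) ^ 2 + y ^ 2)) μ := by
  simpa only [RCLike.im_eq_complex_im, one_div_sub_im] using (integrable_one_div_sub μ x hy).im

/-- The imaginary part of the Borel transform is the Poisson integral of the measure. -/
lemma borelTransform_im (μ : Measure ℝ) [IsFiniteMeasure μ] (x : ℝ) {y : ℝ} (hy : 0 < y) :
    (borelTransform μ ((x : ℂ) + y * Complex.I)).im = ∫ t : ℝ, y / ((t - x) ^ 2 + y ^ 2) ∂μ := by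
  have h := integral_im (integrable_one_div_sub μ x hy)
  simp only [RCLike.im_eq_complex_im, one_div_sub_im] at h
  exact h.symm

lemma real_closedBall_div_le_borelTransform_im (μ : Measure ℝ) [IsFiniteMeasure μ] (x : ℝ) {y : ℝ}
    (hy : 0 < y) :
    μ.real (Metric.closedBall x y) / (2 * y) ≤
      (borelTransform μ ((x : ℂ) + y * Complex.I)).im := by
  rw [borelTransform_im μ x hy]
  calc μ.real (Metric.closedBall x y) / (2 * y)
      = ∫ t, (Metric.closedBall x y).indicator (fun _ => 1 / (2 * y)) t ∂μ := by
        rw [integral_indicator_const _ Metric.isClosed_closedBall.measurableSet, smul_eq_mul]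
        ring
    _ ≤ _ := by
        refine integral_mono
          ((integrable_const _).indicator Metric.isClosed_closedBall.measurableSet)
          (integrable_poissonKernel μ x hy) fun t => ?_
        refine indicator_apply_le' (fun ht => ?_) (fun _ => by positivity)
        rw [Metric.mem_closedBall, Real.dist_eq] at ht
        have h2 : (t - x) ^ 2 ≤ y ^ 2 := sq_le_sq' (by linarith [neg_abs_le (t - x)])
          (by linarith [le_abs_self (t - x)])
        rw [div_le_div_iff₀ (by positivity) (by positivity)]
        nlinarith

/-- The Poisson kernel is dominated on one of the dyadic balls of radius `2 ^ k * y`. -/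
lemma exists_poissonKernel_le (x t : ℝ) {y : ℝ} (hy : 0 < y) :
    ∃ k : ℕ, t ∈ Metric.closedBall x (2 ^ k * y) ∧
      y / ((t - x) ^ 2 + y ^ 2) ≤ 4 / (4 ^ k * y) := by
  classical
  have hex : ∃ k : ℕ, |t - x| ≤ 2 ^ k * y := by
    obtain ⟨k, hk⟩ := pow_unbounded_of_one_lt (|t - x| / y) (one_lt_two (α := ℝ))
    exact ⟨k, ((div_lt_iff₀ hy).1 hk).le⟩
  refine ⟨Nat.find hex, ?_, ?_⟩
  · rw [Metric.mem_closedBall, Real.dist_eq]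
    exact Nat.find_spec hex
  · rw [div_le_div_iff₀ (by positivity) (by positivity)]
    rcases hk : Nat.find hex with _ | k
    · nlinarith [sq_nonneg (t - x)]
    · have h := Nat.find_min hex (m := k) (by omega)
      push Not at h
      have h2 : (2 ^ k * y) ^ 2 ≤ (t - x) ^ 2 := by
        rw [← sq_abs (t - x)]
        gcongr
      have h4 : (4 : ℝ) ^ k = (2 ^ k) ^ 2 := by
        rw [← pow_mul, mul_comm, pow_mul]
        norm_num
      rw [pow_succ, h4]
      nlinarith [sq_nonneg y]

lemma borelTransform_im_le_tsum (μ : Measure ℝ) [IsFiniteMeasure μ] (x : ℝ) {y : ℝ} (hy : 0 < y)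
    (hs : Summable fun k : ℕ => 4 / (4 ^ k * y) * μ.real (Metric.closedBall x (2 ^ k * y))) :
    (borelTransform μ ((x : ℂ) + y * Complex.I)).im ≤
      ∑' k : ℕ, 4 / (4 ^ k * y) * μ.real (Metric.closedBall x (2 ^ k * y)) := by
  have hnn : ∀ k : ℕ, 0 ≤ 4 / (4 ^ k * y) * μ.real (Metric.closedBall x (2 ^ k * y)) :=
    fun k => by positivity
  rw [borelTransform_im μ x hy, integral_eq_lintegral_of_nonneg_ae
    (Eventually.of_forall fun t => by positivity)
    (integrable_poissonKernel μ x hy).aestronglyMeasurable]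
  refine ENNReal.toReal_le_of_le_ofReal (tsum_nonneg hnn) ?_
  rw [ENNReal.ofReal_tsum_of_nonneg hnn hs]
  calc ∫⁻ t, ENNReal.ofReal (y / ((t - x) ^ 2 + y ^ 2)) ∂μ
      ≤ ∫⁻ t, ∑' k : ℕ, (Metric.closedBall x (2 ^ k * y)).indicator
          (fun _ => ENNReal.ofReal (4 / (4 ^ k * y))) t ∂μ := by
        refine lintegral_mono fun t => ?_
        obtain ⟨k, hk, hle⟩ := exists_poissonKernel_le x t hy
        refine le_trans ?_ (ENNReal.le_tsum k)
        rw [indicator_of_mem hk]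
        exact ENNReal.ofReal_le_ofReal hle
    _ = _ := by
        rw [lintegral_tsum fun k => (measurable_const.indicator
          Metric.isClosed_closedBall.measurableSet).aemeasurable]
        refine tsum_congr fun k => ?_
        rw [lintegral_indicator_const Metric.isClosed_closedBall.measurableSet,
          ENNReal.ofReal_mul (by positivity), ofReal_measureReal]

/-- If the density of `μ` at `x` vanishes, then so does the limit of `Im F(x + iy)`. -/
lemma tendsto_borelTransform_im_of_tendsto_density (μ : Measure ℝ) [IsFiniteMeasure μ] (x : ℝ)
    (h : Tendsto (fun r => μ.real (Metric.closedBall x r) / r) (nhdsWithin 0 (Ioi 0)) (nhds 0)) :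
    Tendsto (fun y : ℝ => (borelTransform μ ((x : ℂ) + y * Complex.I)).im)
      (nhdsWithin 0 (Ioi 0)) (nhds 0) := by
  obtain ⟨C, hC⟩ : ∃ C, ∀ r, 0 < r → μ.real (Metric.closedBall x r) / r ≤ C := by
    obtain ⟨δ, hδ, hsub⟩ := mem_nhdsGT_iff_exists_Ioc_subset.1
      (h.eventually (gt_mem_nhds one_pos))
    have hδ : 0 < δ := hδ
    refine ⟨max 1 (μ.real univ / δ), fun r hr => ?_⟩
    rcases le_or_gt r δ with hle | hlt
    · exact le_max_of_le_left (hsub ⟨hr, hle⟩ : _ < (1 : ℝ)).le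
    · refine le_max_of_le_right ?_
      exact div_le_div₀ measureReal_nonneg (measureReal_mono (subset_univ _)) hδ hlt.le
  have hterm : ∀ y : ℝ, 0 < y → ∀ k : ℕ,
      4 / (4 ^ k * y) * μ.real (Metric.closedBall x (2 ^ k * y)) =
        4 * (1 / 2) ^ k * (μ.real (Metric.closedBall x (2 ^ k * y)) / (2 ^ k * y)) := by
    intro y hy k
    have h4 : (4 : ℝ) ^ k = 2 ^ k * 2 ^ k := by
      rw [← mul_pow]
      norm_num
    rw [h4, one_div, inv_pow]
    field_simp
  have hsum : Summable fun k : ℕ => 4 * (1 / 2 : ℝ) ^ k * C :=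
    (summable_geometric_two.mul_left 4).mul_right C
  have hbound : ∀ y : ℝ, 0 < y → ∀ k : ℕ,
      ‖4 / (4 ^ k * y) * μ.real (Metric.closedBall x (2 ^ k * y))‖ ≤ 4 * (1 / 2) ^ k * C := by
    intro y hy k
    rw [Real.norm_of_nonneg (by positivity), hterm y hy k]
    exact mul_le_mul_of_nonneg_left (hC _ (by positivity)) (by positivity)
  have hlim := tendsto_tsum_of_dominated_convergence (𝓕 := nhdsWithin (0 : ℝ) (Ioi 0))
    (f := fun y k => 4 / (4 ^ k * y) * μ.real (Metric.closedBall x (2 ^ k * y)))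
    (g := fun _ : ℕ => 0) hsum
    (fun k => by
      have hmap : Tendsto (fun y : ℝ => 2 ^ k * y) (nhdsWithin 0 (Ioi 0))
          (nhdsWithin 0 (Ioi 0)) := by
        refine tendsto_nhdsWithin_iff.2 ⟨?_, ?_⟩
        · exact ((continuous_const_mul _).tendsto' 0 0 (mul_zero _)).mono_left nhdsWithin_le_nhds
        · filter_upwards [self_mem_nhdsWithin] with y (hy : 0 < y)
          exact mem_Ioi.2 (by positivity)
      have h0 := (h.comp hmap).const_mul (4 * (1 / 2 : ℝ) ^ k)
      rw [mul_zero] at h0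
      refine h0.congr' ?_
      filter_upwards [self_mem_nhdsWithin] with y hy
      exact (hterm y hy k).symm)
    (by
      filter_upwards [self_mem_nhdsWithin] with y hy
      exact hbound y hy)
  rw [tsum_zero] at hlim
  refine squeeze_zero' ?_ ?_ hlim
  · filter_upwards [self_mem_nhdsWithin] with y (hy : 0 < y)
    exact le_trans (by positivity) (real_closedBall_div_le_borelTransform_im μ x hy)
  · filter_upwards [self_mem_nhdsWithin] with y (hy : 0 < y)
    exact borelTransform_im_le_tsum μ x hy (hsum.of_norm_bounded (hbound y hy))

/-- At almost every point the density of `μ` is given by real quotients over shrinking balls. -/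
lemma ae_tendsto_real_closedBall_div (μ : Measure ℝ) [IsFiniteMeasure μ] :
    ∀ᵐ x : ℝ, Tendsto (fun r => μ.real (Metric.closedBall x r) / (2 * r)) (nhdsWithin 0 (Ioi 0))
      (nhds (μ.rnDeriv volume x).toReal) := by
  filter_upwards [Besicovitch.ae_tendsto_rnDeriv μ (volume : Measure ℝ),
    Measure.rnDeriv_lt_top μ volume] with x hx hlt
  refine ((ENNReal.tendsto_toReal hlt.ne).comp hx).congr' ?_
  filter_upwards [self_mem_nhdsWithin] with r (hr : 0 < r)
  simp [Real.volume_closedBall, Measure.real, ENNReal.toReal_div, hr.le]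

/-- The absolutely continuous part of `μ` vanishes on `(a, b)` if and only if
`Im F(x+iy) → 0` as `y ↘ 0` for Lebesgue-a.e. `x ∈ (a, b)`. -/
theorem acPart_eq_zero_iff (μ : Measure ℝ) [IsFiniteMeasure μ] (a b : ℝ) (hab : a < b) :
    (volume : Measure ℝ).withDensity (μ.rnDeriv volume) (Set.Ioo a b) = 0 ↔
      ∀ᵐ x : ℝ ∂(volume.restrict (Set.Ioo a b)),
        Tendsto (fun y : ℝ => (borelTransform μ ((x : ℂ) + y * Complex.I)).im)
          (nhdsWithin 0 (Set.Ioi 0)) (nhds 0) := by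
  rw [withDensity_apply _ measurableSet_Ioo,
    lintegral_eq_zero_iff (Measure.measurable_rnDeriv μ volume)]
  refine eventually_congr ?_
  filter_upwards [ae_restrict_of_ae (ae_tendsto_real_closedBall_div μ),
    ae_restrict_of_ae (Measure.rnDeriv_lt_top μ volume)] with x hx hlt
  constructor
  · intro h0
    refine tendsto_borelTransform_im_of_tendsto_density μ x ?_
    rw [h0] at hx
    have h2 := hx.const_mul 2
    simp only [Pi.zero_apply, ENNReal.toReal_zero, mul_zero] at h2
    refine h2.congr fun r => ?_
    ring
  · intro h
    have h0 : Tendsto (fun r => μ.real (Metric.closedBall x r) / (2 * r))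
        (nhdsWithin 0 (Ioi 0)) (nhds 0) := by
      refine squeeze_zero' ?_ ?_ h
      · filter_upwards [self_mem_nhdsWithin] with y (hy : 0 < y)
        positivity
      · filter_upwards [self_mem_nhdsWithin] with y (hy : 0 < y)
        exact real_closedBall_div_le_borelTransform_im μ x hy
    exact ((ENNReal.toReal_eq_zero_iff _).1 (tendsto_nhds_unique hx h0)).resolve_right hlt.ne
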